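/- (Multivariate uniform convergence of the quasi-interpolation operator.) Let q and α be real numbers with 0 < q < 1 and α > 0, let N be a positive integer, and let f : ℝ^N → ℝ be bounded and uniformly continuous. For a positive integer n and x ∈ ℝ^N define A_n(f; x) = Σ_{k ∈ ℤ^N} f(k/n) · Z_{q,α}(n x − k), where Z_{q,α}(x) = Π_{i=1}^N ψ_{q,α}(x_i); the series converges absolutely. Then sup_{x ∈ ℝ^N} |A_n(f; x) − f(x)| → 0 as n → ∞. -/

import Mathlib

/-- The generalized hyperbolic tangent activation function. -/
noncomputable def h (q α x : ℝ) : ℝ :=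
  (Real.exp (α * x) - q * Real.exp (-(α * x))) /
    ((1 + q) * Real.exp (α * x) + (1 - q) * Real.exp (-(α * x)))

/-- The associated density function. -/
noncomputable def ψ (q α x : ℝ) : ℝ :=
  ((1 - q ^ 2) / (2 * (1 + q ^ 2))) * (h q α (x + 1) - h q α (x - 1))

/-- The multivariate product density function on ℝ^N. -/
noncomputable def Z (q α : ℝ) {N : ℕ} (x : Fin N → ℝ) : ℝ :=
  ∏ i : Fin N, ψ q α (x i)

/-- The multivariate quasi-interpolation neural network operator. -/
noncomputable def A (q α : ℝ) {N : ℕ} (n : ℕ) (f : (Fin N → ℝ) → ℝ) (x : Fin N → ℝ) : ℝ :=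
  ∑' k : Fin N → ℤ, f (fun i => (k i : ℝ) / n) * Z q α (fun i => n * x i - k i)

open Filter Topology

/-- The sum of the increments of a monotone two-sided sequence is the difference of its limits. -/
lemma hasSum_int_increments {a : ℤ → ℝ} (ha : Monotone a) {L l : ℝ}
    (hL : Tendsto a atTop (𝓝 L)) (hl : Tendsto a atBot (𝓝 l)) :
    HasSum (fun k => a (k + 1) - a k) (L - l) := by
  have h₁ : HasSum (fun n : ℕ => a ((n : ℤ) + 1) - a n) (L - a 0) := by
    rw [hasSum_iff_tendsto_nat_of_nonneg (fun n => sub_nonneg.2 (ha (by lia)))]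
    have hsum : ∀ n : ℕ, ∑ i ∈ Finset.range n, (a ((i : ℤ) + 1) - a i) = a n - a 0 := by
      intro n
      have := Finset.sum_range_sub (fun i : ℕ => a i) n
      simpa using this
    simp only [hsum]
    exact (hL.comp tendsto_natCast_atTop_atTop).sub_const _
  have h₂ : HasSum (fun n : ℕ => a (-((n : ℤ) + 1) + 1) - a (-((n : ℤ) + 1))) (a 0 - l) := by
    rw [hasSum_iff_tendsto_nat_of_nonneg (fun n => sub_nonneg.2 (ha (by lia)))]
    have hsum : ∀ n : ℕ, ∑ i ∈ Finset.range n,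
        (a (-((i : ℤ) + 1) + 1) - a (-((i : ℤ) + 1))) = a 0 - a (-(n : ℤ)) := by
      intro n
      have := Finset.sum_range_sub' (fun i : ℕ => a (-(i : ℤ))) n
      simpa using this
    simp only [hsum]
    exact (hl.comp (tendsto_neg_atTop_atBot.comp tendsto_natCast_atTop_atTop)).const_sub _
  convert HasSum.of_nat_of_neg_add_one (f := fun k : ℤ => a (k + 1) - a k) h₁ h₂ using 1
  ring

/-- A product of convergent nonnegative series is the series of the products. -/
lemma hasSum_pi_prod {ι : Type*} {N : ℕ} {g : Fin N → ι → ℝ} {s : Fin N → ℝ}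
    (hg : ∀ i k, 0 ≤ g i k) (hs : ∀ i, HasSum (g i) (s i)) :
    HasSum (fun k : Fin N → ι => ∏ i, g i (k i)) (∏ i, s i) := by
  induction N with
  | zero => simp
  | succ N ih =>
    have ih' := ih (fun i k => hg i.succ k) (fun i => hs i.succ)
    have hsm := (hs 0).summable.mul_of_nonneg ih'.summable (hg 0)
      (fun k => Finset.prod_nonneg fun i _ => hg i.succ (k i))
    have hmul := (hs 0).mul ih' hsm
    rw [← (Fin.consEquiv (fun _ => ι)).hasSum_iff, Fin.prod_univ_succ]
    have hcons : (fun k : Fin (N + 1) → ι => ∏ i, g i (k i)) ∘ Fin.consEquiv (fun _ => ι) =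
        fun p => g 0 p.1 * ∏ i, g i.succ (p.2 i) := by
      ext p
      simp [Fin.consEquiv, Fin.prod_univ_succ]
    rw [hcons]
    exact hmul

section Activation

variable {q α : ℝ}

lemma h_eq_sub_div (hq0 : 0 < q) (hq1 : q < 1) (x : ℝ) :
    h q α x = 1 / (1 + q) -
      (1 + q ^ 2) / (1 + q) / ((1 + q) * Real.exp (2 * α * x) + (1 - q)) := by
  have hden : 0 < (1 + q) * Real.exp (2 * α * x) + (1 - q) := by
    have := Real.exp_pos (2 * α * x)
    have : 0 < 1 - q := by linarith
    positivity
  have hexp : Real.exp (2 * α * x) = Real.exp (α * x) * Real.exp (α * x) := by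
    rw [← Real.exp_add]; ring_nf
  have hE := Real.exp_pos (α * x)
  rw [h, Real.exp_neg]
  rw [hexp] at hden ⊢
  generalize Real.exp (α * x) = E at hden hE ⊢
  have hnum : (1 + q) * E + (1 - q) * E⁻¹ = ((1 + q) * (E * E) + (1 - q)) / E := by
    field_simp
  rw [hnum]
  generalize hD : (1 + q) * (E * E) + (1 - q) = D at hden ⊢
  field_simp
  rw [← hD]
  ring

lemma h_monotone (hq0 : 0 < q) (hq1 : q < 1) (hα : 0 < α) : Monotone (h q α) := by
  intro x y hxy
  have : 0 < 1 - q := by linarith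
  rw [h_eq_sub_div hq0 hq1, h_eq_sub_div hq0 hq1]
  gcongr

lemma h_tendsto_atTop (hq0 : 0 < q) (hq1 : q < 1) (hα : 0 < α) :
    Tendsto (h q α) atTop (𝓝 (1 / (1 + q))) := by
  have hexp : Tendsto (fun x => Real.exp (2 * α * x)) atTop atTop :=
    Real.tendsto_exp_atTop.comp (tendsto_id.const_mul_atTop (by positivity))
  have := (((hexp.const_mul_atTop (by positivity : 0 < 1 + q)).atTop_add
    (tendsto_const_nhds (x := 1 - q))).const_div_atTop ((1 + q ^ 2) / (1 + q))).const_sub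
      (1 / (1 + q))
  simpa [funext (h_eq_sub_div (α := α) hq0 hq1)] using this

lemma h_tendsto_atBot (hq0 : 0 < q) (hq1 : q < 1) (hα : 0 < α) :
    Tendsto (h q α) atBot (𝓝 (-q / (1 - q))) := by
  have hq : 1 - q ≠ 0 := by linarith
  have hexp : Tendsto (fun x => Real.exp (2 * α * x)) atBot (𝓝 0) :=
    Real.tendsto_exp_atBot.comp (tendsto_id.const_mul_atBot (by positivity))
  have := ((tendsto_const_nhds (x := (1 + q ^ 2) / (1 + q))).div
    ((hexp.const_mul (1 + q)).add_const (1 - q)) (by simpa using hq)).const_sub (1 / (1 + q))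
  have hlim : 1 / (1 + q) - (1 + q ^ 2) / (1 + q) / ((1 + q) * 0 + (1 - q)) = -q / (1 - q) := by
    rw [mul_zero, zero_add]
    field_simp
    ring
  rw [hlim] at this
  exact this.congr fun x => (h_eq_sub_div hq0 hq1 x).symm

lemma hasSum_h_increments (hq0 : 0 < q) (hq1 : q < 1) (hα : 0 < α) (y : ℝ) :
    HasSum (fun k : ℤ => h q α (y + 1 - k) - h q α (y - k)) ((1 + q ^ 2) / (1 - q ^ 2)) := by
  have key := hasSum_int_increments (a := fun k : ℤ => h q α (y + k))
    (fun i j hij => h_monotone hq0 hq1 hα (by gcongr))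
    ((h_tendsto_atTop hq0 hq1 hα).comp
      (tendsto_atTop_add_const_left _ y tendsto_intCast_atTop_atTop))
    ((h_tendsto_atBot hq0 hq1 hα).comp
      (tendsto_atBot_add_const_left _ y (tendsto_intCast_atBot_iff.2 tendsto_id)))
  rw [← (Equiv.neg ℤ).hasSum_iff] at key
  have hq : 1 - q ≠ 0 := by linarith
  have hq2 : 1 - q ^ 2 ≠ 0 := by nlinarith
  convert key using 1
  · ext k
    simp only [Function.comp_apply, Equiv.neg_apply]
    push_cast
    ring_nf
  · rw [show 1 - q ^ 2 = (1 - q) * (1 + q) by ring]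
    field_simp
    ring

lemma density_const_pos (hq0 : 0 < q) (hq1 : q < 1) : 0 < (1 - q ^ 2) / (2 * (1 + q ^ 2)) := by
  have : 0 < 1 - q ^ 2 := by nlinarith
  positivity

lemma ψ_nonneg (hq0 : 0 < q) (hq1 : q < 1) (hα : 0 < α) (x : ℝ) : 0 ≤ ψ q α x :=
  mul_nonneg (density_const_pos hq0 hq1).le
    (sub_nonneg.2 (h_monotone hq0 hq1 hα (by linarith)))

/-- The integer translates of the density form a partition of unity. -/
lemma hasSum_ψ (hq0 : 0 < q) (hq1 : q < 1) (hα : 0 < α) (y : ℝ) :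
    HasSum (fun k : ℤ => ψ q α (y - k)) 1 := by
  have hq2 : 1 - q ^ 2 ≠ 0 := by nlinarith
  have key := ((hasSum_h_increments hq0 hq1 hα y).add
    (hasSum_h_increments hq0 hq1 hα (y - 1))).mul_left ((1 - q ^ 2) / (2 * (1 + q ^ 2)))
  have hone : (1 - q ^ 2) / (2 * (1 + q ^ 2)) *
      ((1 + q ^ 2) / (1 - q ^ 2) + (1 + q ^ 2) / (1 - q ^ 2)) = 1 := by
    field_simp
    norm_num
  rw [hone] at key
  have hterm : (fun k : ℤ => ψ q α (y - k)) = fun k : ℤ => (1 - q ^ 2) / (2 * (1 + q ^ 2)) *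
      (h q α (y + 1 - k) - h q α (y - k) + (h q α (y - 1 + 1 - k) - h q α (y - 1 - k))) := by
    ext k
    rw [ψ]
    ring_nf
  rwa [hterm]

/-- A bound for the translate `ψ q α (t - j)` that is uniform in `t ∈ [0, 1]`. -/
noncomputable def densityMajorant (q α : ℝ) (j : ℤ) : ℝ :=
  ((1 - q ^ 2) / (2 * (1 + q ^ 2))) * (h q α (2 - j) - h q α (-1 - j))

lemma ψ_le_densityMajorant (hq0 : 0 < q) (hq1 : q < 1) (hα : 0 < α) {t : ℝ}
    (ht0 : 0 ≤ t) (ht1 : t ≤ 1) (j : ℤ) : ψ q α (t - j) ≤ densityMajorant q α j :=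
  mul_le_mul_of_nonneg_left
    (sub_le_sub (h_monotone hq0 hq1 hα (by linarith)) (h_monotone hq0 hq1 hα (by linarith)))
    (density_const_pos hq0 hq1).le

lemma densityMajorant_nonneg (hq0 : 0 < q) (hq1 : q < 1) (hα : 0 < α) (j : ℤ) :
    0 ≤ densityMajorant q α j :=
  (ψ_nonneg hq0 hq1 hα _).trans (ψ_le_densityMajorant hq0 hq1 hα le_rfl zero_le_one j)

lemma summable_densityMajorant (hq0 : 0 < q) (hq1 : q < 1) (hα : 0 < α) :
    Summable (densityMajorant q α) := by
  have H := fun y => (hasSum_h_increments hq0 hq1 hα y).summable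
  refine ((((H (-1)).add (H 0)).add (H 1)).mul_left
    ((1 - q ^ 2) / (2 * (1 + q ^ 2)))).congr fun j => ?_
  rw [densityMajorant]
  ring_nf

lemma hasSum_Z (hq0 : 0 < q) (hq1 : q < 1) (hα : 0 < α) {N : ℕ} (y : Fin N → ℝ) :
    HasSum (fun k : Fin N → ℤ => Z q α (fun i => y i - k i)) 1 := by
  simpa [Z] using hasSum_pi_prod (fun i k => ψ_nonneg hq0 hq1 hα (y i - (k : ℤ)))
    (fun i => hasSum_ψ hq0 hq1 hα (y i))

lemma Z_nonneg (hq0 : 0 < q) (hq1 : q < 1) (hα : 0 < α) {N : ℕ} (y : Fin N → ℝ) :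
    0 ≤ Z q α y :=
  Finset.prod_nonneg fun i _ => ψ_nonneg hq0 hq1 hα (y i)

end Activation

section Modulus

variable {X : Type*} {f : X → ℝ} {M : ℝ}

lemma abs_sub_le_two_mul (hM : ∀ x, |f x| ≤ M) (x y : X) : |f x - f y| ≤ 2 * M := by
  have := abs_sub (f x) (f y)
  linarith [hM x, hM y]

variable [PseudoMetricSpace X]

/-- The modulus of continuity of a real function on a metric space. -/
noncomputable def modulus (f : X → ℝ) (δ : ℝ) : ℝ :=
  ⨆ p : {p : X × X // dist p.1 p.2 ≤ δ}, |f p.1.1 - f p.1.2|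

lemma modulus_nonneg (f : X → ℝ) (δ : ℝ) : 0 ≤ modulus f δ :=
  Real.iSup_nonneg fun _ => abs_nonneg _

lemma modulus_le (hM0 : 0 ≤ M) (hM : ∀ x, |f x| ≤ M) (δ : ℝ) : modulus f δ ≤ 2 * M :=
  Real.iSup_le (fun _ => abs_sub_le_two_mul hM _ _) (by positivity)

lemma abs_sub_le_modulus (hM : ∀ x, |f x| ≤ M) {x y : X} {δ : ℝ} (hxy : dist x y ≤ δ) :
    |f x - f y| ≤ modulus f δ :=
  le_ciSup (f := fun p : {p : X × X // dist p.1 p.2 ≤ δ} => |f p.1.1 - f p.1.2|)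
    ⟨2 * M, by rintro _ ⟨p, rfl⟩; exact abs_sub_le_two_mul hM _ _⟩ ⟨(x, y), hxy⟩

lemma modulus_tendsto_zero (hf : UniformContinuous f) : Tendsto (modulus f) (𝓝 0) (𝓝 0) := by
  rw [Metric.tendsto_nhds]
  intro ε hε
  obtain ⟨δ, hδ, hfδ⟩ := Metric.uniformContinuous_iff.1 hf (ε / 2) (half_pos hε)
  filter_upwards [gt_mem_nhds hδ] with r hr
  rw [Real.dist_0_eq_abs, abs_of_nonneg (modulus_nonneg f r)]
  refine lt_of_le_of_lt (Real.iSup_le (fun p => ?_) (half_pos hε).le) (half_lt_self hε)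
  exact (hfδ (p.2.trans_lt hr)).le

end Modulus

/-- The pointwise error of the operator is bounded by a series that does not depend on the
point. -/
lemma abs_A_sub_le {q α : ℝ} (hq0 : 0 < q) (hq1 : q < 1) (hα : 0 < α) {N : ℕ}
    {f : (Fin N → ℝ) → ℝ} {M : ℝ} (hM0 : 0 ≤ M) (hM : ∀ x, |f x| ≤ M)
    (hG : Summable fun j : Fin N → ℤ => ∏ i, densityMajorant q α (j i))
    {n : ℕ} (hn : 0 < n) (x : Fin N → ℝ) :
    |A q α n f x - f x| ≤
      ∑' j : Fin N → ℤ, modulus f ((‖j‖ + 1) / n) * ∏ i, densityMajorant q α (j i) := by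
  have hn' : (0 : ℝ) < n := by exact_mod_cast hn
  have hG0 : ∀ j : Fin N → ℤ, 0 ≤ ∏ i, densityMajorant q α (j i) := fun j =>
    Finset.prod_nonneg fun i _ => densityMajorant_nonneg hq0 hq1 hα (j i)
  have hZ := hasSum_Z hq0 hq1 hα (fun i => n * x i)
  have hfZ : Summable fun k : Fin N → ℤ =>
      f (fun i => (k i : ℝ) / n) * Z q α (fun i => n * x i - k i) := by
    refine Summable.of_norm_bounded (hZ.summable.mul_left M) fun k => ?_
    rw [norm_mul, Real.norm_eq_abs, Real.norm_of_nonneg (Z_nonneg hq0 hq1 hα _)]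
    exact mul_le_mul_of_nonneg_right (hM _) (Z_nonneg hq0 hq1 hα _)
  have hdiff := hfZ.hasSum.sub (hZ.mul_left (f x))
  rw [mul_one, ← (Equiv.addLeft fun i => ⌊n * x i⌋).hasSum_iff] at hdiff
  have hbound : Summable fun j : Fin N → ℤ =>
      modulus f ((‖j‖ + 1) / n) * ∏ i, densityMajorant q α (j i) :=
    Summable.of_nonneg_of_le (fun j => mul_nonneg (modulus_nonneg _ _) (hG0 j))
      (fun j => mul_le_mul_of_nonneg_right (modulus_le hM0 hM _) (hG0 j)) (hG.mul_left (2 * M))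
  rw [A, ← hdiff.tsum_eq, ← Real.norm_eq_abs]
  refine tsum_of_norm_bounded hbound.hasSum fun j => ?_
  have hfl : ∀ i, (⌊n * x i⌋ : ℝ) + Int.fract (n * x i) = n * x i := fun i =>
    Int.floor_add_fract _
  simp only [Function.comp_apply, Equiv.coe_addLeft, Pi.add_apply]
  rw [← sub_mul, norm_mul, Real.norm_eq_abs, Real.norm_of_nonneg (Z_nonneg hq0 hq1 hα _)]
  refine mul_le_mul (abs_sub_le_modulus hM ?_) ?_ (Z_nonneg hq0 hq1 hα _) (modulus_nonneg _ _)
  · refine (dist_pi_le_iff (by positivity)).2 fun i => ?_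
    have hx : ((⌊n * x i⌋ + j i : ℤ) : ℝ) / n - x i = (j i - Int.fract (n * x i)) / n := by
      rw [eq_div_iff hn'.ne', sub_mul, div_mul_cancel₀ _ hn'.ne']
      push_cast
      linarith [hfl i]
    rw [Real.dist_eq, hx, abs_div, abs_of_pos hn']
    gcongr
    refine (abs_sub _ _).trans (add_le_add ?_ ?_)
    · simpa [Int.norm_eq_abs] using norm_le_pi_norm j i
    · rw [abs_of_nonneg (Int.fract_nonneg _)]
      exact (Int.fract_lt_one _).le
  · refine Finset.prod_le_prod (fun i _ => ψ_nonneg hq0 hq1 hα _) fun i _ => ?_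
    have hx : n * x i - ((⌊n * x i⌋ + j i : ℤ) : ℝ) = Int.fract (n * x i) - j i := by
      push_cast
      linarith [hfl i]
    beta_reduce
    rw [hx]
    exact ψ_le_densityMajorant hq0 hq1 hα (Int.fract_nonneg _) (Int.fract_lt_one _).le _

theorem multivariate_uniform_convergence (q α : ℝ) (hq0 : 0 < q) (hq1 : q < 1)
    (hα : 0 < α) (N : ℕ) (hN : 0 < N) (f : (Fin N → ℝ) → ℝ)
    (hbd : ∃ M : ℝ, ∀ x : Fin N → ℝ, |f x| ≤ M) (hf : UniformContinuous f) :
    Filter.Tendsto (fun n : ℕ => ⨆ x : Fin N → ℝ, |A q α n f x - f x|)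
      Filter.atTop (nhds 0) := by
  obtain ⟨M, hM⟩ := hbd
  have hM0 : 0 ≤ M := (abs_nonneg _).trans (hM 0)
  have hG0 : ∀ j : Fin N → ℤ, 0 ≤ ∏ i, densityMajorant q α (j i) := fun j =>
    Finset.prod_nonneg fun i _ => densityMajorant_nonneg hq0 hq1 hα (j i)
  have hG : Summable fun j : Fin N → ℤ => ∏ i, densityMajorant q α (j i) :=
    (hasSum_pi_prod (g := fun _ => densityMajorant q α)
      (fun _ k => densityMajorant_nonneg hq0 hq1 hα k)
      (fun _ => (summable_densityMajorant hq0 hq1 hα).hasSum)).summable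
  have hlim : Tendsto (fun n : ℕ => ∑' j : Fin N → ℤ,
      modulus f ((‖j‖ + 1) / n) * ∏ i, densityMajorant q α (j i)) atTop (𝓝 0) := by
    rw [← tsum_zero (α := ℝ) (β := Fin N → ℤ)]
    refine tendsto_tsum_of_dominated_convergence (hG.mul_left (2 * M)) (fun j => ?_)
      (Eventually.of_forall fun n j => ?_)
    · simpa using ((modulus_tendsto_zero hf).comp
        (tendsto_const_div_atTop_nhds_zero_nat (‖j‖ + 1))).mul_const
          (∏ i, densityMajorant q α (j i))
    · rw [Real.norm_of_nonneg (mul_nonneg (modulus_nonneg _ _) (hG0 j))]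
      exact mul_le_mul_of_nonneg_right (modulus_le hM0 hM _) (hG0 j)
  refine squeeze_zero' (Eventually.of_forall fun n => Real.iSup_nonneg fun x => abs_nonneg _)
    ?_ hlim
  filter_upwards [eventually_gt_atTop 0] with n hn
  exact Real.iSup_le (abs_A_sub_le hq0 hq1 hα hM0 hM hG hn)
    (tsum_nonneg fun j => mul_nonneg (modulus_nonneg _ _) (hG0 j))
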